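/- Let (J^ℱ,(f_n)) and (J^𝒢,(g_n)) be two monotonically equivalent ℓ-modal nonautonomous discrete dynamical systems, and assume that both satisfy the multimodal limit property. Then (J^ℱ,(f_n)) and (J^𝒢,(g_n)) are topologically conjugate if and only if they have the same kneading sequences. -/

import Mathlib

open Set

noncomputable section

/-- The nonautonomous iterate `f_n^m = f_{n+m-1} ∘ ⋯ ∘ f_n` (and `f_n^0 = id`). -/
def iterFrom (f : ℕ → ℝ → ℝ) : ℕ → ℕ → ℝ → ℝ
  | _, 0, x => x
  | n, m + 1, x => f (n + m) (iterFrom f n m x)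

/-- The extended turning-point function: `cext 0 = a`, `cext j = c j` for `1 ≤ j ≤ l`,
and `cext (l+1) = b`.  The `j`-th lap of the map at level `n` is
`[cext … n (j-1), cext … n j]` for `1 ≤ j ≤ l+1`. -/
def cext (a b : ℝ) (l : ℕ) (c : ℕ → ℕ → ℝ) (n j : ℕ) : ℝ :=
  if j = 0 then a else if j ≤ l then c n j else b

/-- `(Icc a b, (f n))` is an `l`-modal nonautonomous discrete dynamical system with
turning points `c n 1 < ⋯ < c n l`; `d n j` records whether `f n` is strictly
increasing (`true`) or strictly decreasing (`false`) on its `j`-th lap, and adjacent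
laps have opposite monotonicity type.  The boundary values `f n a` and `f n b` are
independent of `n` and belong to `{a, b}`. -/
def IsMNDS (a b : ℝ) (l : ℕ) (f : ℕ → ℝ → ℝ) (c : ℕ → ℕ → ℝ) (d : ℕ → ℕ → Bool) :
    Prop :=
  a < b ∧ 1 ≤ l ∧
  ((∀ n, f n a = a) ∨ (∀ n, f n a = b)) ∧
  ((∀ n, f n b = a) ∨ (∀ n, f n b = b)) ∧
  ∀ n : ℕ,
    ContinuousOn (f n) (Icc a b) ∧
    MapsTo (f n) (Icc a b) (Icc a b) ∧
    (∀ j : ℕ, 1 ≤ j → j ≤ l + 1 → cext a b l c n (j - 1) < cext a b l c n j) ∧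
    (∀ j : ℕ, 1 ≤ j → j ≤ l + 1 →
      if d n j then StrictMonoOn (f n) (Icc (cext a b l c n (j - 1)) (cext a b l c n j))
      else StrictAntiOn (f n) (Icc (cext a b l c n (j - 1)) (cext a b l c n j))) ∧
    (∀ j : ℕ, 1 ≤ j → j ≤ l → d n (j + 1) = !d n j)

/-- The address set of the `i`-th lap at level `n`:
`I_n(1) = [a, c_n(1))`, `I_n(i) = (c_n(i-1), c_n(i))` for `2 ≤ i ≤ l`,
`I_n(l+1) = (c_n(l), b]`. -/
def lapAddr (a b : ℝ) (l : ℕ) (c : ℕ → ℕ → ℝ) (n i : ℕ) : Set ℝ :=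
  if i = 1 then Ico a (c n 1)
  else if i ≤ l then Ioo (c n (i - 1)) (c n i)
  else Ioc (c n l) b

/-- Two `l`-MNDS have the same kneading sequences: for each turning point index `j`,
all `n` and `m`, `f_n^m(c_n^ℱ(j))` equals the `i`-th turning point (resp. lies in the
`i`-th lap) at level `n+m` iff the same holds for `g_n^m(c_n^𝒢(j))`. -/
def SameKneadingM (aF bF aG bG : ℝ) (l : ℕ) (f : ℕ → ℝ → ℝ) (cF : ℕ → ℕ → ℝ)
    (g : ℕ → ℝ → ℝ) (cG : ℕ → ℕ → ℝ) : Prop :=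
  ∀ j : ℕ, 1 ≤ j → j ≤ l → ∀ n m : ℕ,
    (∀ i : ℕ, 1 ≤ i → i ≤ l →
      (iterFrom f n m (cF n j) = cF (n + m) i ↔ iterFrom g n m (cG n j) = cG (n + m) i)) ∧
    (∀ i : ℕ, 1 ≤ i → i ≤ l + 1 →
      (iterFrom f n m (cF n j) ∈ lapAddr aF bF l cF (n + m) i ↔
        iterFrom g n m (cG n j) ∈ lapAddr aG bG l cG (n + m) i))

/-- `𝒞_n(ℱ)` for an `l`-MNDS: points eventually mapped onto some turning point. -/
def critSetM (a b : ℝ) (l : ℕ) (f : ℕ → ℝ → ℝ) (c : ℕ → ℕ → ℝ) (n : ℕ) : Set ℝ :=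
  {x ∈ Icc a b | ∃ m : ℕ, ∃ j : ℕ, 1 ≤ j ∧ j ≤ l ∧ iterFrom f n m x = c (n + m) j}

/-- The single-map extended turning-point function for an `l`-modal map. -/
def cextMap (a b : ℝ) (l : ℕ) (cc : ℕ → ℝ) (j : ℕ) : ℝ :=
  if j = 0 then a else if j ≤ l then cc j else b

/-- An `l`-modal map on `Icc a b` with turning points `cc 1 < ⋯ < cc l` and lap
monotonicity types `d j`, adjacent laps being of opposite type. -/
def IsLModalMap (a b : ℝ) (l : ℕ) (g : ℝ → ℝ) (cc : ℕ → ℝ) (d : ℕ → Bool) : Prop :=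
  ContinuousOn g (Icc a b) ∧
  MapsTo g (Icc a b) (Icc a b) ∧
  (∀ j : ℕ, 1 ≤ j → j ≤ l + 1 → cextMap a b l cc (j - 1) < cextMap a b l cc j) ∧
  (∀ j : ℕ, 1 ≤ j → j ≤ l + 1 →
    if d j then StrictMonoOn g (Icc (cextMap a b l cc (j - 1)) (cextMap a b l cc j))
    else StrictAntiOn g (Icc (cextMap a b l cc (j - 1)) (cextMap a b l cc j))) ∧
  (∀ j : ℕ, 1 ≤ j → j ≤ l → d (j + 1) = !d j)

/-- `𝒞(g)` for an autonomous `l`-modal map `g`. -/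
def critSetMMap (a b : ℝ) (l : ℕ) (g : ℝ → ℝ) (cc : ℕ → ℝ) : Set ℝ :=
  {x ∈ Icc a b | ∃ m : ℕ, ∃ j : ℕ, 1 ≤ j ∧ j ≤ l ∧ g^[m] x = cc j}

/-- The multimodal limit property: there is an `l`-modal map `g` whose turning points
are non-periodic and are never mapped onto a turning point (`g^[m] (cc i) ≠ cc j` for
all `m ≥ 1`), with `f n → g` uniformly, `𝒞_n(ℱ)` dense for all `n`, and `𝒞(g)` dense. -/
def LimitPropertyM (a b : ℝ) (l : ℕ) (f : ℕ → ℝ → ℝ) (c : ℕ → ℕ → ℝ) : Prop :=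
  ∃ (g : ℝ → ℝ) (cc : ℕ → ℝ) (d : ℕ → Bool),
    IsLModalMap a b l g cc d ∧
    (∀ i : ℕ, 1 ≤ i → i ≤ l → ∀ j : ℕ, 1 ≤ j → j ≤ l →
      ∀ m : ℕ, 1 ≤ m → g^[m] (cc i) ≠ cc j) ∧
    TendstoUniformlyOn (fun n => f n) g Filter.atTop (Icc a b) ∧
    (∀ n : ℕ, Icc a b ⊆ closure (critSetM a b l f c n)) ∧
    Icc a b ⊆ closure (critSetMMap a b l g cc)

/-- Topological conjugacy of two NDS on compact intervals. -/
def TopConjugate (aF bF aG bG : ℝ) (f g : ℕ → ℝ → ℝ) : Prop :=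
  ∃ h : ℕ → ℝ → ℝ,
    (∀ n, StrictMonoOn (h n) (Icc aF bF)) ∧
    (∀ n, ContinuousOn (h n) (Icc aF bF)) ∧
    (∀ n, BijOn (h n) (Icc aF bF) (Icc aG bG)) ∧
    (∀ ε > (0:ℝ), ∃ δ > (0:ℝ), ∀ n, ∀ x ∈ Icc aF bF, ∀ y ∈ Icc aF bF,
      |x - y| < δ → |h n x - h n y| < ε) ∧
    (∀ ε > (0:ℝ), ∃ δ > (0:ℝ), ∀ n, ∀ x ∈ Icc aF bF, ∀ y ∈ Icc aF bF,
      |h n x - h n y| < δ → |x - y| < ε) ∧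
    (∀ n, ∀ x ∈ Icc aF bF, h (n + 1) (f n x) = g n (h n x))

namespace IsLModalMap

open Filter Topology

variable {a b : ℝ} {l : ℕ} {φ : ℝ → ℝ} {cc : ℕ → ℝ} {d : ℕ → Bool}

theorem cextMap_zero : cextMap a b l cc 0 = a := by simp [cextMap]

theorem cextMap_last : cextMap a b l cc (l + 1) = b := by simp [cextMap]

theorem cextMap_turning {i : ℕ} (h1 : 1 ≤ i) (hl : i ≤ l) : cextMap a b l cc i = cc i := by
  have : i ≠ 0 := by omega
  simp [cextMap, this, hl]

theorem cextMap_lt (h : IsLModalMap a b l φ cc d) {i j : ℕ} (hij : i < j) (hj : j ≤ l + 1) :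
    cextMap a b l cc i < cextMap a b l cc j := by
  induction j, hij using Nat.le_induction with
  | base => simpa using h.2.2.1 (i + 1) (by omega) hj
  | succ k hk ih =>
    exact (ih (by omega)).trans (by simpa using h.2.2.1 (k + 1) (by omega) hj)

theorem cextMap_le (h : IsLModalMap a b l φ cc d) {i j : ℕ} (hij : i ≤ j) (hj : j ≤ l + 1) :
    cextMap a b l cc i ≤ cextMap a b l cc j := by
  rcases hij.eq_or_lt with rfl | hlt
  · exact le_rfl
  · exact (h.cextMap_lt hlt hj).le

theorem left_le_cextMap (h : IsLModalMap a b l φ cc d) {i : ℕ} (hi : i ≤ l + 1) :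
    a ≤ cextMap a b l cc i := by
  simpa [cextMap_zero] using h.cextMap_le (Nat.zero_le i) hi

theorem cextMap_le_right (h : IsLModalMap a b l φ cc d) {i : ℕ} (hi : i ≤ l + 1) :
    cextMap a b l cc i ≤ b := by
  simpa [cextMap_last] using h.cextMap_le hi le_rfl

theorem left_lt_right (h : IsLModalMap a b l φ cc d) : a < b := by
  simpa [cextMap_zero, cextMap_last] using h.cextMap_lt (Nat.succ_pos l) le_rfl

theorem left_lt_turning (h : IsLModalMap a b l φ cc d) {i : ℕ} (h1 : 1 ≤ i) (hl : i ≤ l) :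
    a < cc i := by
  simpa [cextMap_zero, cextMap_turning h1 hl] using h.cextMap_lt (i := 0) (j := i) h1 (by omega)

theorem turning_lt_right (h : IsLModalMap a b l φ cc d) {i : ℕ} (h1 : 1 ≤ i) (hl : i ≤ l) :
    cc i < b := by
  simpa [cextMap_last, cextMap_turning h1 hl] using
    h.cextMap_lt (i := i) (j := l + 1) (by omega) le_rfl

theorem turning_mem (h : IsLModalMap a b l φ cc d) {i : ℕ} (h1 : 1 ≤ i) (hl : i ≤ l) :
    cc i ∈ Icc a b :=
  ⟨(h.left_lt_turning h1 hl).le, (h.turning_lt_right h1 hl).le⟩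

theorem turning_lt (h : IsLModalMap a b l φ cc d) {i j : ℕ} (h1 : 1 ≤ i) (hij : i < j)
    (hl : j ≤ l) : cc i < cc j := by
  simpa [cextMap_turning h1 (hij.le.trans hl), cextMap_turning (h1.trans hij.le) hl] using
    h.cextMap_lt hij (by omega)

theorem turning_lt_iff (h : IsLModalMap a b l φ cc d) {i j : ℕ} (hi : 1 ≤ i) (hil : i ≤ l)
    (hj : 1 ≤ j) (hjl : j ≤ l) : cc i < cc j ↔ i < j := by
  refine ⟨fun hlt => ?_, fun hlt => h.turning_lt hi hlt hjl⟩
  by_contra hcon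
  rcases (not_lt.mp hcon).eq_or_lt with rfl | hji
  · exact lt_irrefl _ hlt
  · exact lt_asymm hlt (h.turning_lt hj hji hil)

/-- On its `(k+1)`-st lap the map is strictly monotone of the type recorded by `d (k+1)`. -/
theorem monotone_on_lap (h : IsLModalMap a b l φ cc d) {k : ℕ} (hk : k ≤ l) :
    (d (k + 1) = true ∧ StrictMonoOn φ (Icc (cextMap a b l cc k) (cextMap a b l cc (k + 1)))) ∨
    (d (k + 1) = false ∧
      StrictAntiOn φ (Icc (cextMap a b l cc k) (cextMap a b l cc (k + 1)))) := by
  have := h.2.2.2.1 (k + 1) (by omega) (by omega)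
  cases hd : d (k + 1) <;> simp_all

theorem lap_subset (h : IsLModalMap a b l φ cc d) {k : ℕ} (hk : k ≤ l) :
    Icc (cextMap a b l cc k) (cextMap a b l cc (k + 1)) ⊆ Icc a b :=
  Icc_subset_Icc (h.left_le_cextMap (by omega)) (h.cextMap_le_right (by omega))

/-- An interval without turning points in its interior is contained in one lap. -/
theorem exists_lap (_h : IsLModalMap a b l φ cc d) {x x' : ℝ} (hx : a ≤ x) (hx' : x' ≤ b)
    (hno : ∀ i, 1 ≤ i → i ≤ l → x < cc i → x' ≤ cc i) :
    ∃ k ≤ l, cextMap a b l cc k ≤ x ∧ x' ≤ cextMap a b l cc (k + 1) := by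
  classical
  set k := Nat.findGreatest (fun k => cextMap a b l cc k ≤ x) l with hk
  have hkl : k ≤ l := Nat.findGreatest_le l
  have hkx : cextMap a b l cc k ≤ x :=
    Nat.findGreatest_spec (P := fun k => cextMap a b l cc k ≤ x) (Nat.zero_le l)
      (by simpa [cextMap_zero] using hx)
  refine ⟨k, hkl, hkx, ?_⟩
  rcases hkl.eq_or_lt with he | hlt
  · rw [he, cextMap_last]; exact hx'
  · have := Nat.findGreatest_is_greatest (P := fun k => cextMap a b l cc k ≤ x) (n := l)
      (k := k + 1) (by omega) hlt
    rw [cextMap_turning (by omega) (by omega)] at this ⊢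
    exact hno _ (by omega) (by omega) (not_le.mp this)

theorem exists_turning_of_fold (h : IsLModalMap a b l φ cc d) {u v w : ℝ} (hu : a ≤ u)
    (huv : u < v) (hvw : v < w) (hw : w ≤ b)
    (hfold : (φ u < φ v ∧ φ w < φ v) ∨ (φ v < φ u ∧ φ v < φ w)) :
    ∃ i, 1 ≤ i ∧ i ≤ l ∧ u < cc i ∧ cc i < w := by
  by_contra! hcon
  obtain ⟨k, hk, hku, hkw⟩ := h.exists_lap hu hw hcon
  have mu : u ∈ Icc (cextMap a b l cc k) (cextMap a b l cc (k + 1)) := ⟨hku, by linarith⟩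
  have mv : v ∈ Icc (cextMap a b l cc k) (cextMap a b l cc (k + 1)) :=
    ⟨by linarith, by linarith⟩
  have mw : w ∈ Icc (cextMap a b l cc k) (cextMap a b l cc (k + 1)) := ⟨by linarith, hkw⟩
  rcases h.monotone_on_lap hk with ⟨-, hm⟩ | ⟨-, hm⟩
  · have h1 := hm mu mv huv
    have h2 := hm mv mw hvw
    rcases hfold with ⟨h3, h4⟩ | ⟨h3, h4⟩ <;> linarith
  · have h1 := hm mu mv huv
    have h2 := hm mv mw hvw
    rcases hfold with ⟨h3, h4⟩ | ⟨h3, h4⟩ <;> linarith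

/-- The image of a nondegenerate interval inside a lap is a nondegenerate interval. -/
theorem image_interval (h : IsLModalMap a b l φ cc d) {k : ℕ} (hk : k ≤ l) {x x' : ℝ}
    (hx : cextMap a b l cc k ≤ x) (hxx : x < x') (hx' : x' ≤ cextMap a b l cc (k + 1)) :
    ∃ u u', a ≤ u ∧ u < u' ∧ u' ≤ b ∧ Icc u u' ⊆ φ '' Icc x x' ∧
      ∀ z ∈ Ioo x x', φ z ∈ Ioo u u' := by
  have hsub : Icc x x' ⊆ Icc (cextMap a b l cc k) (cextMap a b l cc (k + 1)) :=
    Icc_subset_Icc hx hx'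
  have hc : ContinuousOn φ (Icc x x') := h.1.mono (hsub.trans (h.lap_subset hk))
  have mx : x ∈ Icc x x' := left_mem_Icc.mpr hxx.le
  have mx' : x' ∈ Icc x x' := right_mem_Icc.mpr hxx.le
  have ix := h.2.1 (h.lap_subset hk (hsub mx))
  have ix' := h.2.1 (h.lap_subset hk (hsub mx'))
  rcases h.monotone_on_lap hk with ⟨-, hm⟩ | ⟨-, hm⟩
  · refine ⟨φ x, φ x', ix.1, hm (hsub mx) (hsub mx') hxx, ix'.2,
      intermediate_value_Icc hxx.le hc, fun z hz => ?_⟩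
    have mz := hsub (Ioo_subset_Icc_self hz)
    exact ⟨hm (hsub mx) mz hz.1, hm mz (hsub mx') hz.2⟩
  · refine ⟨φ x', φ x, ix'.1, hm (hsub mx) (hsub mx') hxx, ix.2,
      intermediate_value_Icc' hxx.le hc, fun z hz => ?_⟩
    have mz := hsub (Ioo_subset_Icc_self hz)
    exact ⟨hm mz (hsub mx') hz.2, hm (hsub mx) mz hz.1⟩

theorem congr_types {d' : ℕ → Bool} (h : IsLModalMap a b l φ cc d)
    (hd : ∀ j, 1 ≤ j → j ≤ l + 1 → d j = d' j) : IsLModalMap a b l φ cc d' := by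
  refine ⟨h.1, h.2.1, h.2.2.1, fun j h1 hj => ?_, fun j h1 hj => ?_⟩
  · rw [← hd j h1 hj]; exact h.2.2.2.1 j h1 hj
  · rw [← hd j h1 (by omega), ← hd (j + 1) (by omega) (by omega)]; exact h.2.2.2.2 j h1 hj

theorem map_left (h : IsLModalMap a b l φ cc d) (ha : φ a = a ∨ φ a = b) :
    φ a = if d 1 then a else b := by
  have h01 := h.cextMap_lt (i := 0) (j := 1) (by omega) (by omega)
  have m0 : a ∈ Icc (cextMap a b l cc 0) (cextMap a b l cc 1) := by
    rw [cextMap_zero] at *; exact left_mem_Icc.mpr h01.le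
  have m1 := right_mem_Icc.mpr h01.le
  have himg := h.2.1 (h.lap_subset (Nat.zero_le l) m1)
  rw [cextMap_zero] at h01
  rcases h.monotone_on_lap (Nat.zero_le l) with ⟨hd, hm⟩ | ⟨hd, hm⟩
  · have := hm m0 m1 h01
    rcases ha with ha | ha
    · simp_all
    · exact absurd himg.2 (by rw [ha] at this; exact not_le.mpr this)
  · have := hm m0 m1 h01
    rcases ha with ha | ha
    · exact absurd himg.1 (by rw [ha] at this; exact not_le.mpr this)
    · simp_all

theorem map_right (h : IsLModalMap a b l φ cc d) (hb : φ b = a ∨ φ b = b) :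
    φ b = if d (l + 1) then b else a := by
  have h01 := h.cextMap_lt (i := l) (j := l + 1) (by omega) (by omega)
  have m0 : b ∈ Icc (cextMap a b l cc l) (cextMap a b l cc (l + 1)) := by
    rw [cextMap_last] at *; exact right_mem_Icc.mpr h01.le
  have m1 := left_mem_Icc.mpr h01.le
  have himg := h.2.1 (h.lap_subset le_rfl m1)
  rw [cextMap_last] at h01
  rcases h.monotone_on_lap le_rfl with ⟨hd, hm⟩ | ⟨hd, hm⟩
  · have := hm m1 m0 h01
    rcases hb with hb | hb
    · exact absurd himg.1 (by rw [hb] at this; exact not_le.mpr this)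
    · simp_all
  · have := hm m1 m0 h01
    rcases hb with hb | hb
    · simp_all
    · exact absurd himg.2 (by rw [hb] at this; exact not_le.mpr this)

/-- Order isomorphisms that conjugate two modal maps of the same type match turning points. -/
theorem conj_cextMap {a' b' : ℝ} {γ : ℝ → ℝ} {cc' : ℕ → ℝ} (h : IsLModalMap a b l φ cc d)
    (h' : IsLModalMap a' b' l γ cc' d) {p q : ℝ → ℝ} (hp : StrictMonoOn p (Icc a b))
    (hbij : BijOn p (Icc a b) (Icc a' b')) (hq : StrictMonoOn q (Icc a b))
    (hpq : ∀ x ∈ Icc a b, q (φ x) = γ (p x)) {i : ℕ} (hi : i ≤ l) :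
    p (cextMap a b l cc i) = cextMap a' b' l cc' i := by
  have opposite : ∀ {j : ℕ}, j + 1 ≤ l → ∀ {s t : ℝ}, s < t → s ∈ Icc a b → t ∈ Icc a b →
      ¬ (φ s < φ t ∧ γ (p t) < γ (p s)) ∧ ¬ (φ t < φ s ∧ γ (p s) < γ (p t)) := by
    intro j hj s t hst hs ht
    rw [← hpq s hs, ← hpq t ht]
    constructor
    · rintro ⟨h1, h2⟩
      exact lt_asymm h2 (hq (h.2.1 hs) (h.2.1 ht) h1)
    · rintro ⟨h1, h2⟩
      exact lt_asymm h2 (hq (h.2.1 ht) (h.2.1 hs) h1)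
  induction i with
  | zero =>
    rw [cextMap_zero, cextMap_zero]
    have ma : a ∈ Icc a b := left_mem_Icc.mpr h.left_lt_right.le
    obtain ⟨x, hx, hxa⟩ := hbij.surjOn (left_mem_Icc.mpr h'.left_lt_right.le)
    refine le_antisymm ?_ (hbij.mapsTo ma).1
    rw [← hxa]
    exact hp.monotoneOn ma hx hx.1
  | succ i ih =>
    specialize ih (by omega)
    have e01 := h.cextMap_lt (i := i) (j := i + 1) (by omega) (by omega)
    have e12 := h.cextMap_lt (i := i + 1) (j := i + 2) (by omega) (by omega)
    have e01' := h'.cextMap_lt (i := i) (j := i + 1) (by omega) (by omega)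
    have e12' := h'.cextMap_lt (i := i + 1) (j := i + 2) (by omega) (by omega)
    have m0 : cextMap a b l cc i ∈ Icc a b :=
      ⟨h.left_le_cextMap (by omega), h.cextMap_le_right (by omega)⟩
    have m1 : cextMap a b l cc (i + 1) ∈ Icc a b :=
      ⟨h.left_le_cextMap (by omega), h.cextMap_le_right (by omega)⟩
    have m2 : cextMap a b l cc (i + 2) ∈ Icc a b :=
      ⟨h.left_le_cextMap (by omega), h.cextMap_le_right (by omega)⟩
    have m1' : cextMap a' b' l cc' (i + 1) ∈ Icc a' b' :=
      ⟨h'.left_le_cextMap (by omega), h'.cextMap_le_right (by omega)⟩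
    have m2' : cextMap a' b' l cc' (i + 2) ∈ Icc a' b' :=
      ⟨h'.left_le_cextMap (by omega), h'.cextMap_le_right (by omega)⟩
    obtain ⟨r, hr, hpr⟩ := hbij.surjOn m1'
    obtain ⟨t, ht, hpt⟩ := hbij.surjOn m2'
    have hd : d (i + 2) = !d (i + 1) := h.2.2.2.2 (i + 1) (by omega) (by omega)
    have hrt : r < t := by
      rw [← hp.lt_iff_lt hr ht, hpr, hpt]; exact e12'
    have h0r : cextMap a b l cc i < r := by
      rw [← hp.lt_iff_lt m0 hr, hpr, ih]; exact e01'
    rcases lt_trichotomy (cextMap a b l cc (i + 1)) r with hlt | heq | hgt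
    · set s := min (cextMap a b l cc (i + 2)) r with hs
      have h1s : cextMap a b l cc (i + 1) < s := lt_min e12 hlt
      have ms : s ∈ Icc a b := ⟨m1.1.trans h1s.le, (min_le_left _ _).trans m2.2⟩
      have hop := opposite hi h1s m1 ms
      have l1 : cextMap a b l cc (i + 1) ∈
          Icc (cextMap a b l cc (i + 1)) (cextMap a b l cc (i + 2)) := ⟨le_rfl, e12.le⟩
      have ls : s ∈ Icc (cextMap a b l cc (i + 1)) (cextMap a b l cc (i + 2)) :=
        ⟨h1s.le, min_le_left _ _⟩
      have hps : p s ≤ cextMap a' b' l cc' (i + 1) := by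
        rw [← hpr]; exact hp.monotoneOn ms hr (min_le_right _ _)
      have hp1s := hp m1 ms h1s
      have hp01 : cextMap a' b' l cc' i < p (cextMap a b l cc (i + 1)) := by
        rw [← ih]; exact hp m0 m1 e01
      have k1 : p (cextMap a b l cc (i + 1)) ∈
          Icc (cextMap a' b' l cc' i) (cextMap a' b' l cc' (i + 1)) :=
        ⟨hp01.le, hp1s.le.trans hps⟩
      have ks : p s ∈ Icc (cextMap a' b' l cc' i) (cextMap a' b' l cc' (i + 1)) :=
        ⟨(hp01.trans hp1s).le, hps⟩
      rcases h.monotone_on_lap hi with ⟨hd1, hm⟩ | ⟨hd1, hm⟩ <;>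
      rcases h'.monotone_on_lap (k := i) (by omega) with ⟨hd2, hm'⟩ | ⟨hd2, hm'⟩
      · simp [hd1, hd2] at hd
      · exact absurd ⟨hm l1 ls h1s, hm' k1 ks hp1s⟩ hop.1
      · exact absurd ⟨hm l1 ls h1s, hm' k1 ks hp1s⟩ hop.2
      · simp [hd1, hd2] at hd
    · rw [heq, hpr]
    · set s := min (cextMap a b l cc (i + 1)) t with hs
      have hrs : r < s := lt_min hgt hrt
      have ms : s ∈ Icc a b := ⟨hr.1.trans hrs.le, (min_le_left _ _).trans m1.2⟩
      have hop := opposite hi hrs hr ms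
      have lr : r ∈ Icc (cextMap a b l cc i) (cextMap a b l cc (i + 1)) := ⟨h0r.le, hgt.le⟩
      have ls : s ∈ Icc (cextMap a b l cc i) (cextMap a b l cc (i + 1)) :=
        ⟨(h0r.trans hrs).le, min_le_left _ _⟩
      have hps : p s ≤ cextMap a' b' l cc' (i + 2) := by
        rw [← hpt]; exact hp.monotoneOn ms ht (min_le_right _ _)
      have hprs := hp hr ms hrs
      have kr : p r ∈ Icc (cextMap a' b' l cc' (i + 1)) (cextMap a' b' l cc' (i + 2)) := by
        rw [hpr]; exact ⟨le_rfl, e12'.le⟩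
      have ks : p s ∈ Icc (cextMap a' b' l cc' (i + 1)) (cextMap a' b' l cc' (i + 2)) :=
        ⟨kr.1.trans hprs.le, hps⟩
      rcases h.monotone_on_lap (k := i) (by omega) with ⟨hd1, hm⟩ | ⟨hd1, hm⟩ <;>
      rcases h'.monotone_on_lap hi with ⟨hd2, hm'⟩ | ⟨hd2, hm'⟩
      · simp [hd1, hd2] at hd
      · exact absurd ⟨hm lr ls hrs, hm' kr ks hprs⟩ hop.1
      · exact absurd ⟨hm lr ls hrs, hm' kr ks hprs⟩ hop.2
      · simp [hd1, hd2] at hd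

theorem exists_le_forall_le {u : ℕ → ℝ} (K : ℕ) (hu : ∀ i ≤ K, 0 < u i) {ε : ℝ} (hε : 0 < ε) :
    ∃ η > 0, η ≤ ε ∧ ∀ i ≤ K, η ≤ u i := by
  induction K with
  | zero =>
    refine ⟨min ε (u 0), lt_min hε (hu 0 le_rfl), min_le_left _ _, fun i hi => ?_⟩
    rw [Nat.le_zero.mp hi]; exact min_le_right _ _
  | succ K ih =>
    obtain ⟨η, hη, hηε, hle⟩ := ih fun i hi => hu i (by omega)
    refine ⟨min η (u (K + 1)), lt_min hη (hu _ le_rfl), (min_le_left _ _).trans hηε,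
      fun i hi => ?_⟩
    rcases hi.eq_or_lt with rfl | hlt
    · exact min_le_right _ _
    · exact (min_le_left _ _).trans (hle i (by omega))

theorem eq_self_of_strictMono {l : ℕ} {σ : ℕ → ℕ}
    (hσ : ∀ i, 1 ≤ i → i ≤ l → 1 ≤ σ i ∧ σ i ≤ l)
    (hmono : ∀ i j, 1 ≤ i → i < j → j ≤ l → σ i < σ j) {i : ℕ} (h1 : 1 ≤ i) (hl : i ≤ l) :
    σ i = i := by
  have lower : ∀ i, 1 ≤ i → i ≤ l → i ≤ σ i := by
    intro i h1
    induction i, h1 using Nat.le_induction with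
    | base => exact fun h => (hσ 1 le_rfl h).1
    | succ k hk ih =>
      intro h
      have := hmono k (k + 1) hk (by omega) h
      have := ih (by omega)
      omega
  have upper : ∀ k, k < l → σ (l - k) ≤ l - k := by
    intro k
    induction k with
    | zero => exact fun h => (hσ l (by omega) le_rfl).2
    | succ k ih =>
      intro h
      have := hmono (l - (k + 1)) (l - k) (by omega) (by omega) (by omega)
      have := ih (by omega)
      omega
  have h2 := upper (l - i) (by omega)
  rw [show l - (l - i) = i by omega] at h2
  exact le_antisymm h2 (lower i h1 hl)

/-- Turning points of modal maps converge when the maps converge pointwise to a modal map with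
the same number of turning points. -/
theorem tendsto_turning (h : IsLModalMap a b l φ cc d) {f : ℕ → ℝ → ℝ} {c : ℕ → ℕ → ℝ}
    {e : ℕ → ℕ → Bool} (hf : ∀ n, IsLModalMap a b l (f n) (c n) (e n))
    (hlim : ∀ x ∈ Icc a b, Tendsto (fun n => f n x) atTop (𝓝 (φ x))) {i : ℕ} (h1 : 1 ≤ i)
    (hl : i ≤ l) : Tendsto (fun n => c n i) atTop (𝓝 (cc i)) := by
  rw [Metric.tendsto_nhds]
  intro ε hε
  obtain ⟨η, hη, hηε, hgap⟩ := exists_le_forall_le (u := fun i =>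
    (cextMap a b l cc (i + 1) - cextMap a b l cc i) / 2) l
    (fun i hi => by have := h.cextMap_lt (i := i) (j := i + 1) (by omega) (by omega); linarith) hε
  have near : ∀ j ∈ Finset.Icc 1 l, ∀ᶠ n in atTop,
      ∃ s, 1 ≤ s ∧ s ≤ l ∧ cc j - η < c n s ∧ c n s < cc j + η := by
    intro j hj
    rw [Finset.mem_Icc] at hj
    obtain ⟨k, rfl⟩ : ∃ k, j = k + 1 := ⟨j - 1, by omega⟩
    have g1 := hgap k (by omega)
    have g2 := hgap (k + 1) (by omega)
    have ek := cextMap_turning (a := a) (b := b) (cc := cc) hj.1 hj.2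
    rw [ek] at g1 g2
    have hu : a ≤ cc (k + 1) - η := by
      have := h.left_le_cextMap (i := k) (by omega); linarith
    have hw : cc (k + 1) + η ≤ b := by
      have := h.cextMap_le_right (i := k + 1 + 1) (by omega); linarith
    have hc := h.turning_mem hj.1 hj.2
    have tu := hlim (cc (k + 1) - η) ⟨hu, by linarith [hc.2]⟩
    have tc := hlim (cc (k + 1)) hc
    have tw := hlim (cc (k + 1) + η) ⟨by linarith [hc.1], hw⟩
    have mu : cc (k + 1) - η ∈ Icc (cextMap a b l cc k) (cextMap a b l cc (k + 1)) := by
      rw [ek]; constructor <;> linarith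
    have mc : cc (k + 1) ∈ Icc (cextMap a b l cc k) (cextMap a b l cc (k + 1)) := by
      rw [ek]; constructor <;> linarith
    have mw : cc (k + 1) + η ∈
        Icc (cextMap a b l cc (k + 1)) (cextMap a b l cc (k + 1 + 1)) := by
      rw [ek]; constructor <;> linarith
    have mc' : cc (k + 1) ∈ Icc (cextMap a b l cc (k + 1)) (cextMap a b l cc (k + 1 + 1)) := by
      rw [ek]; constructor <;> linarith
    have hd : d (k + 2) = !d (k + 1) := h.2.2.2.2 (k + 1) hj.1 hj.2
    have l1 : cc (k + 1) - η < cc (k + 1) := by linarith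
    have l2 : cc (k + 1) < cc (k + 1) + η := by linarith
    rcases h.monotone_on_lap (k := k) (by omega) with ⟨hd1, hm⟩ | ⟨hd1, hm⟩ <;>
    rcases h.monotone_on_lap hj.2 with ⟨hd2, hm'⟩ | ⟨hd2, hm'⟩
    · simp [hd1, hd2] at hd
    · filter_upwards [tu.eventually_lt tc (hm mu mc l1), tw.eventually_lt tc (hm' mc' mw l2)]
        with n h3 h4
      exact (hf n).exists_turning_of_fold hu l1 l2 hw (Or.inl ⟨h3, h4⟩)
    · filter_upwards [tc.eventually_lt tu (hm mu mc l1), tc.eventually_lt tw (hm' mc' mw l2)]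
        with n h3 h4
      exact (hf n).exists_turning_of_fold hu l1 l2 hw (Or.inr ⟨h3, h4⟩)
    · simp [hd1, hd2] at hd
  filter_upwards [(Filter.eventually_all_finset _).mpr near] with n hn
  choose! σ hσ using hn
  have key : σ i = i := by
    refine eq_self_of_strictMono (l := l) (fun j h1 hl => ?_) (fun j k h1 hjk hl => ?_) h1 hl
    · have := hσ j (Finset.mem_Icc.mpr ⟨h1, hl⟩)
      exact ⟨this.1, this.2.1⟩
    · have hj := hσ j (Finset.mem_Icc.mpr ⟨h1, by omega⟩)
      have hk := hσ k (Finset.mem_Icc.mpr ⟨by omega, hl⟩)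
      rw [← (hf n).turning_lt_iff hj.1 hj.2.1 hk.1 hk.2.1]
      have g := hgap j (by omega)
      have g' := h.cextMap_le (i := j + 1) (j := k) hjk (by omega)
      rw [cextMap_turning (by omega) hl] at g'
      simp only [cextMap_turning (a := a) (b := b) (cc := cc) h1 (show j ≤ l by omega)] at g
      linarith [hj.2.2.2, hk.2.2.1]
  have := hσ i (Finset.mem_Icc.mpr ⟨h1, hl⟩)
  rw [key] at this
  rw [Real.dist_eq, abs_lt]
  constructor <;> linarith [this.2.2.1, this.2.2.2]

end IsLModalMap

theorem iterFrom_succ (f : ℕ → ℝ → ℝ) (n m : ℕ) (x : ℝ) :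
    iterFrom f n (m + 1) x = iterFrom f (n + 1) m (f n x) := by
  induction m with
  | zero => rfl
  | succ m ih =>
    change f (n + (m + 1)) (iterFrom f n (m + 1) x) = _
    rw [ih, show n + (m + 1) = n + 1 + m by omega]
    rfl

/-- An `l`-modal nonautonomous system on `Icc a b` with lap types `d`, whose iterated preimages
of turning points are dense at every level. -/
structure ModalSystem (l : ℕ) (d : ℕ → ℕ → Bool) where
  /-- Left endpoint. -/
  a : ℝ
  /-- Right endpoint. -/
  b : ℝ
  /-- The sequence of maps. -/
  f : ℕ → ℝ → ℝ
  /-- The turning points. -/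
  c : ℕ → ℕ → ℝ
  modal : ∀ n, IsLModalMap a b l (f n) (c n) (d n)
  map_left : ∀ n, f n a = if d n 1 then a else b
  map_right : ∀ n, f n b = if d n (l + 1) then b else a
  dense : ∀ n, Icc a b ⊆ closure (critSetM a b l f c n)

namespace ModalSystem

open Filter Topology

variable {l : ℕ} {d : ℕ → ℕ → Bool} {F G : ModalSystem l d}

/-- The phase space. -/
abbrev J (F : ModalSystem l d) : Set ℝ := Icc F.a F.b

theorem map_mem (F : ModalSystem l d) {x : ℝ} (hx : x ∈ F.J) (n : ℕ) : F.f n x ∈ F.J :=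
  (F.modal n).2.1 hx

theorem iterFrom_mem (F : ModalSystem l d) {x : ℝ} (hx : x ∈ F.J) (n m : ℕ) :
    iterFrom F.f n m x ∈ F.J := by
  induction m with
  | zero => exact hx
  | succ m ih => exact F.map_mem ih _

theorem lt (F : ModalSystem l d) : F.a < F.b := (F.modal 0).left_lt_right

theorem left_mem (F : ModalSystem l d) : F.a ∈ F.J := left_mem_Icc.mpr F.lt.le

theorem right_mem (F : ModalSystem l d) : F.b ∈ F.J := right_mem_Icc.mpr F.lt.le

/-- Two points have the same itinerary starting at level `n`. -/
structure Match (F G : ModalSystem l d) (n : ℕ) (x y : ℝ) : Prop where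
  mem_left : x ∈ F.J
  mem_right : y ∈ G.J
  cmp : ∀ m i, 1 ≤ i → i ≤ l →
    (iterFrom F.f n m x < F.c (n + m) i ↔ iterFrom G.f n m y < G.c (n + m) i) ∧
    (F.c (n + m) i < iterFrom F.f n m x ↔ G.c (n + m) i < iterFrom G.f n m y)

namespace Match

variable {n : ℕ} {x x' y y' : ℝ}

theorem symm (h : Match F G n x y) : Match G F n y x :=
  ⟨h.mem_right, h.mem_left, fun m i h1 hl => ⟨(h.cmp m i h1 hl).1.symm, (h.cmp m i h1 hl).2.symm⟩⟩

theorem next (h : Match F G n x y) : Match F G (n + 1) (F.f n x) (G.f n y) := by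
  refine ⟨F.map_mem h.mem_left n, G.map_mem h.mem_right n, fun m i h1 hl => ?_⟩
  have := h.cmp (m + 1) i h1 hl
  rwa [iterFrom_succ, iterFrom_succ, show n + (m + 1) = n + 1 + m by omega] at this

theorem of_next (hx : x ∈ F.J) (hy : y ∈ G.J)
    (h0 : ∀ i, 1 ≤ i → i ≤ l → (x < F.c n i ↔ y < G.c n i) ∧ (F.c n i < x ↔ G.c n i < y))
    (h : Match F G (n + 1) (F.f n x) (G.f n y)) : Match F G n x y := by
  refine ⟨hx, hy, fun m i h1 hl => ?_⟩
  cases m with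
  | zero => exact h0 i h1 hl
  | succ m =>
    rw [iterFrom_succ, iterFrom_succ, show n + (m + 1) = n + 1 + m by omega]
    exact h.cmp m i h1 hl

theorem lt_turning_iff (h : Match F G n x y) {i : ℕ} (h1 : 1 ≤ i) (hl : i ≤ l) :
    x < F.c n i ↔ y < G.c n i := (h.cmp 0 i h1 hl).1

theorem turning_lt_iff (h : Match F G n x y) {i : ℕ} (h1 : 1 ≤ i) (hl : i ≤ l) :
    F.c n i < x ↔ G.c n i < y := (h.cmp 0 i h1 hl).2

theorem mem_lap (h : Match F G n x y) {k : ℕ} (hk : k ≤ l)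
    (hx : x ∈ Icc (cextMap F.a F.b l (F.c n) k) (cextMap F.a F.b l (F.c n) (k + 1))) :
    y ∈ Icc (cextMap G.a G.b l (G.c n) k) (cextMap G.a G.b l (G.c n) (k + 1)) := by
  constructor
  · rcases Nat.eq_zero_or_pos k with rfl | hk0
    · rw [IsLModalMap.cextMap_zero]; exact h.mem_right.1
    · have := hx.1
      rw [IsLModalMap.cextMap_turning hk0 hk] at this ⊢
      rw [← not_lt] at this ⊢
      rwa [← h.lt_turning_iff hk0 hk]
  · rcases hk.eq_or_lt with rfl | hlt
    · rw [IsLModalMap.cextMap_last]; exact h.mem_right.2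
    · have := hx.2
      rw [IsLModalMap.cextMap_turning (by omega) hlt] at this ⊢
      rw [← not_lt] at this ⊢
      rwa [← h.turning_lt_iff (by omega) hlt]

theorem lt_of_between {z : ℝ} {m j : ℕ} (h : Match F G n x y) (h' : Match F G n x' y')
    (hxz : x < z) (hzx : z < x') (hj : 1 ≤ j) (hjl : j ≤ l)
    (hz : iterFrom F.f n m z = F.c (n + m) j) : y < y' := by
  induction m generalizing n x x' y y' z with
  | zero =>
    change z = F.c n j at hz
    exact ((h.lt_turning_iff hj hjl).mp (hz ▸ hxz)).trans
      ((h'.turning_lt_iff hj hjl).mp (hz ▸ hzx))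
  | succ m ih =>
    by_cases hsep : ∀ i, 1 ≤ i → i ≤ l → x < F.c n i → x' ≤ F.c n i
    · obtain ⟨k, hk, hkx, hkx'⟩ :=
        (F.modal n).exists_lap h.mem_left.1 h'.mem_left.2 hsep
      have mx : x ∈ Icc (cextMap F.a F.b l (F.c n) k) (cextMap F.a F.b l (F.c n) (k + 1)) :=
        ⟨hkx, by linarith⟩
      have mx' : x' ∈ Icc (cextMap F.a F.b l (F.c n) k) (cextMap F.a F.b l (F.c n) (k + 1)) :=
        ⟨by linarith, hkx'⟩
      have mz : z ∈ Icc (cextMap F.a F.b l (F.c n) k) (cextMap F.a F.b l (F.c n) (k + 1)) :=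
        ⟨by linarith, by linarith⟩
      have my := h.mem_lap hk mx
      have my' := h'.mem_lap hk mx'
      rw [iterFrom_succ, show n + (m + 1) = n + 1 + m by omega] at hz
      rcases (F.modal n).monotone_on_lap hk with ⟨hd, hm⟩ | ⟨hd, hm⟩ <;>
      rcases (G.modal n).monotone_on_lap hk with ⟨hd', hm'⟩ | ⟨hd', hm'⟩
      · exact (hm'.lt_iff_lt my my').mp (ih h.next h'.next (hm mx mz hxz) (hm mz mx' hzx) hz)
      · simp [hd] at hd'
      · simp [hd] at hd'
      · exact (hm'.lt_iff_gt my' my).mp (ih h'.next h.next (hm mz mx' hzx) (hm mx mz hxz) hz)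
    · push Not at hsep
      obtain ⟨i, h1, hl, hi, hi'⟩ := hsep
      exact ((h.lt_turning_iff h1 hl).mp hi).trans ((h'.turning_lt_iff h1 hl).mp hi')

end Match

theorem exists_crit_between (F : ModalSystem l d) (n : ℕ) {u v : ℝ} (hu : u ∈ F.J) (hv : v ∈ F.J)
    (huv : u < v) : ∃ z ∈ critSetM F.a F.b l F.f F.c n, u < z ∧ z < v := by
  have hmid : (u + v) / 2 ∈ F.J := ⟨by linarith [hu.1], by linarith [hv.2]⟩
  obtain ⟨z, hz, hzc⟩ := mem_closure_iff.mp (F.dense n hmid) (Ioo u v) isOpen_Ioo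
    ⟨by linarith, by linarith⟩
  exact ⟨z, hzc, hz.1, hz.2⟩

namespace Match

variable {n : ℕ} {x x' y y' : ℝ}

theorem lt_of_lt (h : Match F G n x y) (h' : Match F G n x' y') (hlt : x < x') : y < y' := by
  obtain ⟨z, ⟨-, m, j, hj, hjl, hz⟩, h1, h2⟩ :=
    F.exists_crit_between n h.mem_left h'.mem_left hlt
  exact h.lt_of_between h' h1 h2 hj hjl hz

theorem lt_iff (h : Match F G n x y) (h' : Match F G n x' y') : x < x' ↔ y < y' :=
  ⟨h.lt_of_lt h', h.symm.lt_of_lt h'.symm⟩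

theorem le_iff (h : Match F G n x y) (h' : Match F G n x' y') : x ≤ x' ↔ y ≤ y' := by
  rw [← not_lt, ← not_lt, h'.lt_iff h]

end Match

theorem endpoint_iterFrom (F G : ModalSystem l d) (n m : ℕ) {x y : ℝ}
    (h : x = F.a ∧ y = G.a ∨ x = F.b ∧ y = G.b) :
    iterFrom F.f n m x = F.a ∧ iterFrom G.f n m y = G.a ∨
      iterFrom F.f n m x = F.b ∧ iterFrom G.f n m y = G.b := by
  induction m with
  | zero => exact h
  | succ m ih =>
    simp only [iterFrom]
    rcases ih with ⟨h1, h2⟩ | ⟨h1, h2⟩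
    · rw [h1, h2, F.map_left, G.map_left]
      cases d (n + m) 1 <;> simp
    · rw [h1, h2, F.map_right, G.map_right]
      cases d (n + m) (l + 1) <;> simp

theorem match_endpoint (F G : ModalSystem l d) (n : ℕ) {x y : ℝ}
    (h : x = F.a ∧ y = G.a ∨ x = F.b ∧ y = G.b) : Match F G n x y := by
  refine ⟨?_, ?_, fun m i h1 hl => ?_⟩
  · rcases h with ⟨rfl, -⟩ | ⟨rfl, -⟩
    exacts [F.left_mem, F.right_mem]
  · rcases h with ⟨-, rfl⟩ | ⟨-, rfl⟩
    exacts [G.left_mem, G.right_mem]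
  · have a1 := (F.modal (n + m)).left_lt_turning h1 hl
    have a2 := (G.modal (n + m)).left_lt_turning h1 hl
    have b1 := (F.modal (n + m)).turning_lt_right h1 hl
    have b2 := (G.modal (n + m)).turning_lt_right h1 hl
    rcases endpoint_iterFrom F G n m h with ⟨e1, e2⟩ | ⟨e1, e2⟩ <;> rw [e1, e2]
    · exact ⟨iff_of_true a1 a2, iff_of_false a1.le.not_gt a2.le.not_gt⟩
    · exact ⟨iff_of_false b1.le.not_gt b2.le.not_gt, iff_of_true b1 b2⟩

theorem match_left (F G : ModalSystem l d) (n : ℕ) : Match F G n F.a G.a :=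
  match_endpoint F G n (Or.inl ⟨rfl, rfl⟩)

theorem match_right (F G : ModalSystem l d) (n : ℕ) : Match F G n F.b G.b :=
  match_endpoint F G n (Or.inr ⟨rfl, rfl⟩)

/-- Corresponding turning points have the same itineraries. -/
def SameItin (F G : ModalSystem l d) : Prop :=
  ∀ n j, 1 ≤ j → j ≤ l → Match F G n (F.c n j) (G.c n j)

theorem SameItin.symm (h : SameItin F G) : SameItin G F :=
  fun n j h1 hl => (h n j h1 hl).symm

theorem SameItin.match_cextMap (h : SameItin F G) (n : ℕ) (j : ℕ) :
    Match F G n (cextMap F.a F.b l (F.c n) j) (cextMap G.a G.b l (G.c n) j) := by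
  unfold cextMap
  split_ifs with h0 hl
  · exact match_left F G n
  · exact h n j (by omega) hl
  · exact match_right F G n

theorem cmp_of_mem_lap (F : ModalSystem l d) {n k : ℕ} (hk : k ≤ l) {x : ℝ}
    (hx : x ∈ Ioo (cextMap F.a F.b l (F.c n) k) (cextMap F.a F.b l (F.c n) (k + 1))) {i : ℕ}
    (h1 : 1 ≤ i) (hl : i ≤ l) : (x < F.c n i ↔ k < i) ∧ (F.c n i < x ↔ i ≤ k) := by
  rw [← IsLModalMap.cextMap_turning (a := F.a) (b := F.b) (cc := F.c n) h1 hl]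
  by_cases hki : k < i
  · have : x < cextMap F.a F.b l (F.c n) i :=
      hx.2.trans_le ((F.modal n).cextMap_le hki (by omega))
    exact ⟨iff_of_true this hki, iff_of_false this.le.not_gt (by omega)⟩
  · have : cextMap F.a F.b l (F.c n) i < x :=
      ((F.modal n).cextMap_le (by omega) (by omega)).trans_lt hx.1
    exact ⟨iff_of_false this.le.not_gt hki, iff_of_true this (by omega)⟩

theorem exists_match (h : SameItin F G) {n m j : ℕ} {x : ℝ} (hx : x ∈ F.J) (hj : 1 ≤ j)
    (hjl : j ≤ l) (hm : iterFrom F.f n m x = F.c (n + m) j) : ∃ y, Match F G n x y := by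
  induction m generalizing n x with
  | zero =>
    change x = F.c n j at hm
    exact ⟨_, hm ▸ h n j hj hjl⟩
  | succ m ih =>
    rw [iterFrom_succ, show n + (m + 1) = n + 1 + m by omega] at hm
    obtain ⟨w, hw⟩ := ih (F.map_mem hx n) hm
    obtain ⟨k, hk, hkx, hkx'⟩ := (F.modal n).exists_lap (x := x) (x' := x) hx.1 hx.2
      fun i _ _ hi => hi.le
    have mk := h.match_cextMap n k
    have mk' := h.match_cextMap n (k + 1)
    have ek := (F.modal n).cextMap_lt (i := k) (j := k + 1) (by omega) (by omega)
    have ek' := (G.modal n).cextMap_lt (i := k) (j := k + 1) (by omega) (by omega)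
    rcases hkx.eq_or_lt with rfl | hkx
    · exact ⟨_, mk⟩
    rcases hkx'.eq_or_lt with rfl | hkx'
    · exact ⟨_, mk'⟩
    have l0 := left_mem_Icc.mpr ek.le
    have l1 := right_mem_Icc.mpr ek.le
    have lx : x ∈ Icc (cextMap F.a F.b l (F.c n) k) (cextMap F.a F.b l (F.c n) (k + 1)) :=
      ⟨hkx.le, hkx'.le⟩
    have hcont : ContinuousOn (G.f n)
        (Icc (cextMap G.a G.b l (G.c n) k) (cextMap G.a G.b l (G.c n) (k + 1))) :=
      (G.modal n).1.mono ((G.modal n).lap_subset hk)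
    obtain ⟨y, hy, hyw⟩ : ∃ y ∈ Ioo (cextMap G.a G.b l (G.c n) k)
        (cextMap G.a G.b l (G.c n) (k + 1)), G.f n y = w := by
      rcases (F.modal n).monotone_on_lap hk with ⟨hd, hm⟩ | ⟨hd, hm⟩
      · exact intermediate_value_Ioo ek'.le hcont
          ⟨mk.next.lt_of_lt hw (hm l0 lx hkx), hw.lt_of_lt mk'.next (hm lx l1 hkx')⟩
      · exact intermediate_value_Ioo' ek'.le hcont
          ⟨mk'.next.lt_of_lt hw (hm lx l1 hkx'), hw.lt_of_lt mk.next (hm l0 lx hkx)⟩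
    refine ⟨y, Match.of_next hx ((G.modal n).lap_subset hk (Ioo_subset_Icc_self hy))
      (fun i h1 hl => ?_) (hyw ▸ hw)⟩
    have c1 := F.cmp_of_mem_lap hk ⟨hkx, hkx'⟩ h1 hl
    have c2 := G.cmp_of_mem_lap hk hy h1 hl
    exact ⟨c1.1.trans c2.1.symm, c1.2.trans c2.2.symm⟩

theorem exists_match_between (h : SameItin F G) (n : ℕ) {u v : ℝ} (hu : u ∈ F.J) (hv : v ∈ F.J)
    (huv : u < v) : ∃ x y, Match F G n x y ∧ u < x ∧ x < v := by
  obtain ⟨z, ⟨hzJ, m, j, hj, hjl, hz⟩, h1, h2⟩ := F.exists_crit_between n hu hv huv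
  obtain ⟨y, hy⟩ := exists_match h hzJ hj hjl hz
  exact ⟨z, y, hy, h1, h2⟩

/-- The conjugating maps, extending the correspondence of itineraries. -/
def conj (F G : ModalSystem l d) (n : ℕ) (x : ℝ) : ℝ :=
  sSup {y | ∃ x' ≤ x, Match F G n x' y}

theorem le_conj {n : ℕ} {x x' y : ℝ} (h : Match F G n x' y) (hx : x' ≤ x) :
    y ≤ conj F G n x :=
  le_csSup ⟨G.b, by rintro _ ⟨_, -, h⟩; exact h.mem_right.2⟩ ⟨x', hx, h⟩

theorem conj_le {n : ℕ} {x x' y : ℝ} (hxJ : x ∈ F.J) (h : Match F G n x' y) (hx : x ≤ x') :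
    conj F G n x ≤ y := by
  refine csSup_le ⟨G.a, F.a, hxJ.1, match_left F G n⟩ ?_
  rintro _ ⟨z, hz, hm⟩
  exact (hm.le_iff h).mp (hz.trans hx)

theorem conj_eq {n : ℕ} {x y : ℝ} (h : Match F G n x y) : conj F G n x = y :=
  le_antisymm (conj_le h.mem_left h le_rfl) (le_conj h le_rfl)

theorem conj_mem {n : ℕ} {x : ℝ} (hx : x ∈ F.J) : conj F G n x ∈ G.J :=
  ⟨le_conj (match_left F G n) hx.1, conj_le hx (match_right F G n) hx.2⟩

theorem conj_strictMonoOn (h : SameItin F G) (n : ℕ) : StrictMonoOn (conj F G n) F.J := by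
  intro x hx x' hx' hlt
  obtain ⟨u, y, hu, h1, h2⟩ := exists_match_between h n hx hx' hlt
  obtain ⟨v, y', hv, h3, h4⟩ := exists_match_between h n hu.mem_left hx' h2
  exact ((conj_le hx hu h1.le).trans_lt (hu.lt_of_lt hv h3)).trans_le (le_conj hv h4.le)

theorem conj_conj (h : SameItin F G) (n : ℕ) {x : ℝ} (hx : x ∈ F.J) :
    conj G F n (conj F G n x) = x := by
  have hmem : conj G F n (conj F G n x) ∈ F.J := conj_mem (conj_mem hx)
  rcases lt_trichotomy (conj G F n (conj F G n x)) x with hlt | heq | hgt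
  · obtain ⟨u, y, hu, h1, h2⟩ := exists_match_between h n hmem hx hlt
    exact absurd (le_conj hu.symm (le_conj hu h2.le)) (not_le.mpr h1)
  · exact heq
  · obtain ⟨u, y, hu, h1, h2⟩ := exists_match_between h n hx hmem hgt
    exact absurd (conj_le (conj_mem hx) hu.symm (conj_le hx hu h1.le)) (not_le.mpr h2)

theorem conj_bijOn (h : SameItin F G) (n : ℕ) : BijOn (conj F G n) F.J G.J :=
  InvOn.bijOn ⟨fun _ hx => conj_conj h n hx, fun _ hx => conj_conj h.symm n hx⟩
    (fun _ hx => conj_mem hx) (fun _ hx => conj_mem hx)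

/-- Distances are not contracted too much by a strictly monotone map of a compact interval. -/
theorem _root_.StrictMonoOn.exists_le_sub {a b : ℝ} {h : ℝ → ℝ} (hm : StrictMonoOn h (Icc a b))
    {ε : ℝ} (hε : 0 < ε) : ∃ δ > 0, ∀ x ∈ Icc a b, ∀ y ∈ Icc a b, ε ≤ y - x →
      δ ≤ h y - h x := by
  by_contra! hcon
  choose x hx y hy hxy hlt using fun k : ℕ => hcon (1 / ((k : ℝ) + 1)) Nat.one_div_pos_of_nat
  obtain ⟨p, ⟨hpx, hpy⟩, σ, hσ, hp⟩ := (isCompact_Icc.prod isCompact_Icc).tendsto_subseq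
    (x := fun k => (x k, y k)) (s := Icc a b ×ˢ Icc a b) (fun k => ⟨hx k, hy k⟩)
  have tx : Tendsto (fun k => x (σ k)) atTop (𝓝 p.1) := (continuous_fst.tendsto p).comp hp
  have ty : Tendsto (fun k => y (σ k)) atTop (𝓝 p.2) := (continuous_snd.tendsto p).comp hp
  have hsep : ε ≤ p.2 - p.1 := ge_of_tendsto' (ty.sub tx) fun k => hxy _
  obtain ⟨u, hu1, hu2⟩ := exists_between (show p.1 < p.2 by linarith)
  obtain ⟨v, hv1, hv2⟩ := exists_between hu2
  have mu : u ∈ Icc a b := ⟨hpx.1.trans hu1.le, hu2.le.trans hpy.2⟩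
  have mv : v ∈ Icc a b := ⟨mu.1.trans hv1.le, hv2.le.trans hpy.2⟩
  have huv := hm mu mv hv1
  have t0 : Tendsto (fun k => 1 / ((σ k : ℝ) + 1)) atTop (𝓝 0) :=
    tendsto_one_div_add_atTop_nhds_zero_nat.comp hσ.tendsto_atTop
  obtain ⟨k, hk1, hk2, hk3⟩ := ((tx.eventually_lt_const hu1).and ((ty.eventually_const_lt hv2).and
    (t0.eventually_lt_const (sub_pos.mpr huv)))).exists
  have h1 := hm.monotoneOn (hx _) mu hk1.le
  have h2 := hm.monotoneOn mv (hy _) hk2.le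
  have h3 := hlt (σ k)
  linarith

theorem abs_lt_of_expands {a b : ℝ} {h : ℝ → ℝ} {ε δ : ℝ}
    (hexp : ∀ x ∈ Icc a b, ∀ y ∈ Icc a b, ε ≤ y - x → δ ≤ h y - h x) {x y : ℝ}
    (hx : x ∈ Icc a b) (hy : y ∈ Icc a b) (hlt : |h x - h y| < δ) : |x - y| < ε := by
  by_contra hcon
  rcases le_abs.mp (not_lt.mp hcon) with h1 | h1
  · exact absurd ((hexp y hy x hx h1).trans (le_abs_self _)) (not_le.mpr hlt)
  · rw [neg_sub] at h1
    rw [abs_sub_comm] at hlt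
    exact absurd ((hexp x hx y hy h1).trans (le_abs_self _)) (not_le.mpr hlt)

theorem conj_continuousOn (h : SameItin F G) (n : ℕ) : ContinuousOn (conj F G n) F.J := by
  rw [Metric.continuousOn_iff]
  intro x hx ε hε
  obtain ⟨δ, hδ, hexp⟩ := (conj_strictMonoOn h.symm n).exists_le_sub hε
  refine ⟨δ, hδ, fun y hy hyx => ?_⟩
  refine abs_lt_of_expands hexp (conj_mem hy) (conj_mem hx) ?_
  rwa [conj_conj h n hy, conj_conj h n hx]

theorem conj_map (h : SameItin F G) (n : ℕ) {x : ℝ} (hx : x ∈ F.J) :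
    conj F G (n + 1) (F.f n x) = G.f n (conj F G n x) := by
  have heq : EqOn (fun x => conj F G (n + 1) (F.f n x)) (fun x => G.f n (conj F G n x))
      (critSetM F.a F.b l F.f F.c n) := by
    rintro x ⟨hxJ, m, j, hj, hjl, hm⟩
    obtain ⟨y, hy⟩ := exists_match h hxJ hj hjl hm
    simp only [conj_eq hy, conj_eq hy.next]
  exact heq.of_subset_closure
    ((conj_continuousOn h (n + 1)).comp (F.modal n).1 fun _ hx => F.map_mem hx n)
    ((G.modal n).1.comp (conj_continuousOn h n) fun _ hx => conj_mem hx)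
    (fun _ hx => hx.1) (F.dense n) hx

/-- Points that correspond under an order-preserving conjugacy have the same itinerary. -/
theorem match_of_conjugacy {h : ℕ → ℝ → ℝ} (hm : ∀ n, StrictMonoOn (h n) F.J)
    (hmaps : ∀ n, MapsTo (h n) F.J G.J)
    (hconj : ∀ n, ∀ x ∈ F.J, h (n + 1) (F.f n x) = G.f n (h n x))
    (hturn : ∀ n i, 1 ≤ i → i ≤ l → h n (F.c n i) = G.c n i) (n : ℕ) {x : ℝ} (hx : x ∈ F.J) :
    Match F G n x (h n x) := by
  have hiter : ∀ m, h (n + m) (iterFrom F.f n m x) = iterFrom G.f n m (h n x) := by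
    intro m
    induction m with
    | zero => rfl
    | succ m ih =>
      change h (n + m + 1) (F.f (n + m) _) = G.f (n + m) _
      rw [hconj _ _ (F.iterFrom_mem hx n m), ih]
  refine ⟨hx, hmaps n hx, fun m i h1 hl => ?_⟩
  rw [← hiter m, ← hturn (n + m) i h1 hl]
  have mx := F.iterFrom_mem hx n m
  have mc := (F.modal (n + m)).turning_mem h1 hl
  exact ⟨((hm _).lt_iff_lt mx mc).symm, ((hm _).lt_iff_lt mc mx).symm⟩

theorem match_conj (h : SameItin F G) (n : ℕ) {x : ℝ} (hx : x ∈ F.J) :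
    Match F G n x (conj F G n x) :=
  match_of_conjugacy (conj_strictMonoOn h) (fun _ _ hx => conj_mem hx)
    (fun n _ hx => conj_map h n hx) (fun n i h1 hl => conj_eq (h n i h1 hl)) n hx

end ModalSystem

/-- Weak agreement of the itineraries of `u` and `y` under two autonomous maps. -/
def WeakMatch (l : ℕ) (φ γ : ℝ → ℝ) (p q : ℕ → ℝ) (u y : ℝ) : Prop :=
  ∀ m i, 1 ≤ i → i ≤ l →
    (φ^[m] u < p i → γ^[m] y ≤ q i) ∧ (p i < φ^[m] u → q i ≤ γ^[m] y)

theorem WeakMatch.next {l : ℕ} {φ γ : ℝ → ℝ} {p q : ℕ → ℝ} {u y : ℝ}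
    (h : WeakMatch l φ γ p q u y) : WeakMatch l φ γ p q (φ u) (γ y) :=
  fun m i h1 hl => h (m + 1) i h1 hl

namespace IsLModalMap

open Filter Topology

variable {a b : ℝ} {l : ℕ} {φ γ : ℝ → ℝ} {p q : ℕ → ℝ} {d : ℕ → Bool}

theorem exists_next_interval (h : IsLModalMap a b l φ p d) {x x' y : ℝ} (hx : a ≤ x)
    (hx' : x' ≤ b) (hw : ∀ u ∈ Icc x x', WeakMatch l φ γ p q u y) {m j : ℕ} {z : ℝ}
    (hxz : x < z) (hzx : z < x') (hj : 1 ≤ j) (hjl : j ≤ l) (hz : φ^[m] z = p j) :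
    ∃ k i u u', 1 ≤ i ∧ i ≤ l ∧ γ^[k] y = q i ∧ a ≤ u ∧ u < u' ∧ u' ≤ b ∧
      ∀ v ∈ Icc u u', WeakMatch l φ γ p q v (γ^[k + 1] y) := by
  have turning : ∀ {x x' y : ℝ}, a ≤ x → x' ≤ b →
      (∀ u ∈ Icc x x', WeakMatch l φ γ p q u y) → ∀ {i}, 1 ≤ i → i ≤ l → x < p i → p i < x' →
      ∃ k i u u', 1 ≤ i ∧ i ≤ l ∧ γ^[k] y = q i ∧ a ≤ u ∧ u < u' ∧ u' ≤ b ∧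
        ∀ v ∈ Icc u u', WeakMatch l φ γ p q v (γ^[k + 1] y) := by
    intro x x' y hx hx' hw i h1 hl hxi hix
    have hy : y = q i := le_antisymm
      ((hw x (left_mem_Icc.mpr (hxi.trans hix).le) 0 i h1 hl).1 hxi)
      ((hw x' (right_mem_Icc.mpr (hxi.trans hix).le) 0 i h1 hl).2 hix)
    have e := cextMap_turning (a := a) (b := b) (cc := p) h1 hl
    have hlt := h.cextMap_lt (i := i) (j := i + 1) (by omega) (by omega)
    rw [e] at hlt
    obtain ⟨u, u', hu, huu, hu', himg, -⟩ := h.image_interval hl (x := p i)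
      (x' := min x' (cextMap a b l p (i + 1))) e.le (lt_min hix hlt) (min_le_right _ _)
    refine ⟨0, i, u, u', h1, hl, hy, hu, huu, hu', fun v hv => ?_⟩
    obtain ⟨t, ht, rfl⟩ := himg hv
    exact (hw t ⟨hxi.le.trans ht.1, ht.2.trans (min_le_left _ _)⟩).next
  induction m generalizing x x' y z with
  | zero =>
    change z = p j at hz
    exact turning hx hx' hw hj hjl (hz ▸ hxz) (hz ▸ hzx)
  | succ m ih =>
    by_cases hsep : ∀ i, 1 ≤ i → i ≤ l → x < p i → x' ≤ p i
    · obtain ⟨k, hk, hkx, hkx'⟩ := h.exists_lap hx hx' hsep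
      obtain ⟨u, u', hu, huu, hu', himg, hin⟩ := h.image_interval hk hkx (hxz.trans hzx) hkx'
      have hz' := hin z ⟨hxz, hzx⟩
      obtain ⟨r, i, v, v', h1, hl, hr, hv⟩ := ih (y := γ y) hu hu' (fun w hwu => by
        obtain ⟨t, ht, rfl⟩ := himg hwu
        exact (hw t ht).next) hz'.1 hz'.2 hz
      exact ⟨r + 1, i, v, v', h1, hl, hr, hv⟩
    · push Not at hsep
      obtain ⟨i, h1, hl, hi, hix⟩ := hsep
      exact turning hx hx' hw h1 hl hi hix

/-- No point can weakly match a whole interval if no turning point of `γ` is mapped to a turning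
point. -/
theorem not_weakMatch_interval (h : IsLModalMap a b l φ p d)
    (hdense : Icc a b ⊆ closure (critSetMMap a b l φ p))
    (hγ : ∀ i, 1 ≤ i → i ≤ l → ∀ j, 1 ≤ j → j ≤ l → ∀ m, 1 ≤ m → γ^[m] (q i) ≠ q j)
    {x x' y : ℝ} (hx : a ≤ x) (hlt : x < x') (hx' : x' ≤ b) :
    ¬ ∀ u ∈ Icc x x', WeakMatch l φ γ p q u y := by
  intro hw
  have step : ∀ {x x' y : ℝ}, a ≤ x → x < x' → x' ≤ b →
      (∀ u ∈ Icc x x', WeakMatch l φ γ p q u y) →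
      ∃ k i u u', 1 ≤ i ∧ i ≤ l ∧ γ^[k] y = q i ∧ a ≤ u ∧ u < u' ∧ u' ≤ b ∧
        ∀ v ∈ Icc u u', WeakMatch l φ γ p q v (γ^[k + 1] y) := by
    intro x x' y hx hlt hx' hw
    have hmid : (x + x') / 2 ∈ Icc a b := ⟨by linarith, by linarith⟩
    obtain ⟨z, hz, -, m, j, hj, hjl, hm⟩ := mem_closure_iff.mp (hdense hmid) (Ioo x x') isOpen_Ioo
      ⟨by linarith, by linarith⟩
    exact h.exists_next_interval hx hx' hw hz.1 hz.2 hj hjl hm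
  obtain ⟨k, i, u, u', h1, hl, hk, hu, huu, hu', hw'⟩ := step hx hlt hx' hw
  obtain ⟨r, j, -, -, h1', hl', hr, -⟩ := step hu huu hu' hw'
  refine hγ i h1 hl j h1' hl' (r + 1) (by omega) ?_
  rw [← hk, ← hr, Function.iterate_succ_apply, ← Function.iterate_succ_apply' γ k]

end IsLModalMap

namespace ModalSystem

open Filter Topology

variable {l : ℕ} {d : ℕ → ℕ → Bool} {F G : ModalSystem l d}

theorem tendsto_iterFrom (F : ModalSystem l d) {φ : ℝ → ℝ} (hφ : ContinuousOn φ F.J)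
    (hmaps : MapsTo φ F.J F.J)
    (hlim : TendstoUniformlyOn (fun n => F.f n) φ atTop F.J) {N : ℕ → ℕ}
    (hN : Tendsto N atTop atTop) {x : ℕ → ℝ} {x₀ : ℝ} (hx : ∀ k, x k ∈ F.J) (hx₀ : x₀ ∈ F.J)
    (ht : Tendsto x atTop (𝓝 x₀)) (m : ℕ) :
    Tendsto (fun k => iterFrom F.f (N k) m (x k)) atTop (𝓝 (φ^[m] x₀)) := by
  induction m with
  | zero => exact ht
  | succ m ih =>
    rw [Function.iterate_succ_apply']
    have hmem : φ^[m] x₀ ∈ F.J := hmaps.iterate m hx₀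
    have hN' : Tendsto (fun k => N k + m) atTop atTop :=
      tendsto_atTop_mono (fun k => Nat.le_add_right (N k) m) hN
    have hlim' : TendstoUniformlyOn (fun k => F.f (N k + m)) φ atTop F.J :=
      fun u hu => hN'.eventually (hlim u hu)
    have hwithin : Tendsto (fun k => iterFrom F.f (N k) m (x k)) atTop (𝓝[F.J] (φ^[m] x₀)) :=
      tendsto_nhdsWithin_iff.mpr ⟨ih, Eventually.of_forall fun k => F.iterFrom_mem (hx k) _ _⟩
    change Tendsto (fun k => F.f (N k + m) (iterFrom F.f (N k) m (x k))) atTop (𝓝 (φ (φ^[m] x₀)))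
    exact tendsto_comp_of_locally_uniform_limit_within (hφ _ hmem) hwithin
      fun u hu => ⟨F.J, self_mem_nhdsWithin, hlim' u hu⟩

/-- The autonomous uniform limit required by the multimodal limit property. -/
structure Limit (F : ModalSystem l d) (φ : ℝ → ℝ) (p : ℕ → ℝ) (e : ℕ → Bool) : Prop where
  modal : IsLModalMap F.a F.b l φ p e
  no_connection : ∀ i, 1 ≤ i → i ≤ l → ∀ j, 1 ≤ j → j ≤ l → ∀ m, 1 ≤ m → φ^[m] (p i) ≠ p j
  tendsto : TendstoUniformlyOn (fun n => F.f n) φ atTop F.J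
  dense : F.J ⊆ closure (critSetMMap F.a F.b l φ p)

theorem Limit.tendsto_turning {φ : ℝ → ℝ} {p : ℕ → ℝ} {e : ℕ → Bool} (h : F.Limit φ p e)
    {i : ℕ} (h1 : 1 ≤ i) (hl : i ≤ l) {N : ℕ → ℕ} (hN : Tendsto N atTop atTop) :
    Tendsto (fun k => F.c (N k) i) atTop (𝓝 (p i)) :=
  (h.modal.tendsto_turning F.modal (fun _ hx => h.tendsto.tendsto_at hx) h1 hl).comp hN

theorem weakMatch_of_tendsto {φ γ : ℝ → ℝ} {p q : ℕ → ℝ} {e e' : ℕ → Bool}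
    (hF : F.Limit φ p e) (hG : G.Limit γ q e') {N : ℕ → ℕ} (hN : Tendsto N atTop atTop)
    {y : ℕ → ℝ} {u y₀ : ℝ} (hu : u ∈ F.J) (hy₀ : y₀ ∈ G.J)
    (hy : Tendsto y atTop (𝓝 y₀)) (hm : ∀ k, Match F G (N k) u (y k)) :
    WeakMatch l φ γ p q u y₀ := by
  intro m i h1 hl
  have hN' : Tendsto (fun k => N k + m) atTop atTop :=
      tendsto_atTop_mono (fun k => Nat.le_add_right (N k) m) hN
  have tF := F.tendsto_iterFrom hF.modal.1 hF.modal.2.1 hF.tendsto hN (x := fun _ => u)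
    (fun _ => hu) hu tendsto_const_nhds m
  have tG := G.tendsto_iterFrom hG.modal.1 hG.modal.2.1 hG.tendsto hN
    (fun k => (hm k).mem_right) hy₀ hy m
  have cF := hF.tendsto_turning h1 hl hN'
  have cG := hG.tendsto_turning h1 hl hN'
  constructor
  · intro hlt
    refine le_of_tendsto_of_tendsto tG cG ((tF.eventually_lt cF hlt).mono fun k hk => ?_)
    exact (((hm k).cmp m i h1 hl).1.mp hk).le
  · intro hlt
    refine le_of_tendsto_of_tendsto cG tG ((cF.eventually_lt tF hlt).mono fun k hk => ?_)
    exact (((hm k).cmp m i h1 hl).2.mp hk).le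

theorem eventually_expands {φ γ : ℝ → ℝ} {p q : ℕ → ℝ} {e e' : ℕ → Bool} (h : SameItin F G)
    (hF : F.Limit φ p e) (hG : G.Limit γ q e') {ε : ℝ} (hε : 0 < ε) :
    ∃ M : ℕ, ∃ δ > 0, ∀ n ≥ M, ∀ x ∈ F.J, ∀ x' ∈ F.J, ε ≤ x' - x →
      δ ≤ conj F G n x' - conj F G n x := by
  by_contra! hcon
  choose N hN x hx x' hx' hxx hlt using
    fun k : ℕ => hcon k (1 / ((k : ℝ) + 1)) Nat.one_div_pos_of_nat
  obtain ⟨r, ⟨hr1, hr2, hr3⟩, σ, hσ, hr⟩ :=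
    (isCompact_Icc.prod (isCompact_Icc.prod isCompact_Icc)).tendsto_subseq
    (x := fun k => (x k, x' k, conj F G (N k) (x k))) (s := F.J ×ˢ F.J ×ˢ G.J)
    (fun k => ⟨hx k, hx' k, conj_mem (hx k)⟩)
  have tx : Tendsto (fun k => x (σ k)) atTop (𝓝 r.1) := (continuous_fst.tendsto r).comp hr
  have tx' : Tendsto (fun k => x' (σ k)) atTop (𝓝 r.2.1) :=
    ((continuous_fst.comp continuous_snd).tendsto r).comp hr
  have ty : Tendsto (fun k => conj F G (N (σ k)) (x (σ k))) atTop (𝓝 r.2.2) :=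
    ((continuous_snd.comp continuous_snd).tendsto r).comp hr
  have hsep : ε ≤ r.2.1 - r.1 := ge_of_tendsto' (tx'.sub tx) fun k => hxx _
  have t0 : Tendsto (fun k => 1 / ((σ k : ℝ) + 1)) atTop (𝓝 0) :=
    tendsto_one_div_add_atTop_nhds_zero_nat.comp hσ.tendsto_atTop
  have tu : Tendsto (fun k => conj F G (N (σ k)) (x (σ k)) + 1 / ((σ k : ℝ) + 1)) atTop
      (𝓝 r.2.2) := by simpa using ty.add t0
  have hNσ : Tendsto (fun k => N (σ k)) atTop atTop :=
    (tendsto_atTop_mono hN tendsto_id).comp hσ.tendsto_atTop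
  obtain ⟨u, hu1, hu2⟩ := exists_between (show r.1 < r.2.1 by linarith)
  obtain ⟨v, hv1, hv2⟩ := exists_between hu2
  refine hF.modal.not_weakMatch_interval (y := r.2.2) hF.dense hG.no_connection
    (hr1.1.trans hu1.le) hv1 (hv2.le.trans hr2.2) fun w hw => ?_
  have hw1 : r.1 < w := hu1.trans_le hw.1
  have hw2 : w < r.2.1 := hw.2.trans_lt hv2
  have mw : w ∈ F.J := ⟨hr1.1.trans hw1.le, hw2.le.trans hr2.2⟩
  refine weakMatch_of_tendsto hF hG hNσ mw hr3 ?_ fun k => match_conj h _ mw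
  refine tendsto_of_tendsto_of_tendsto_of_le_of_le' ty tu ?_ ?_
  · filter_upwards [tx.eventually_lt_const hw1] with k hk
    exact (conj_strictMonoOn h _).monotoneOn (hx _) mw hk.le
  · filter_upwards [tx'.eventually_const_lt hw2] with k hk
    have h1 := (conj_strictMonoOn h (N (σ k))).monotoneOn mw (hx' _) hk.le
    have h2 := hlt (σ k)
    linarith

theorem conj_expands {φ γ : ℝ → ℝ} {p q : ℕ → ℝ} {e e' : ℕ → Bool} (h : SameItin F G)
    (hF : F.Limit φ p e) (hG : G.Limit γ q e') {ε : ℝ} (hε : 0 < ε) :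
    ∃ δ > 0, ∀ n, ∀ x ∈ F.J, ∀ x' ∈ F.J, ε ≤ x' - x → δ ≤ conj F G n x' - conj F G n x := by
  obtain ⟨M, δ, hδ, hM⟩ := eventually_expands h hF hG hε
  choose η hη hexp using fun n => (conj_strictMonoOn h n).exists_le_sub hε
  obtain ⟨δ', hδ', hle, hle'⟩ := IsLModalMap.exists_le_forall_le M (fun i _ => hη i) hδ
  refine ⟨δ', hδ', fun n x hx x' hx' hxx => ?_⟩
  rcases le_total M n with hn | hn
  · exact hle.trans (hM n hn x hx x' hx' hxx)
  · exact (hle' n hn).trans (hexp n x hx x' hx' hxx)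

theorem topConjugate_of_sameItin {φ γ : ℝ → ℝ} {p q : ℕ → ℝ} {e e' : ℕ → Bool}
    (h : SameItin F G) (hF : F.Limit φ p e) (hG : G.Limit γ q e') :
    TopConjugate F.a F.b G.a G.b F.f G.f := by
  refine ⟨conj F G, conj_strictMonoOn h, conj_continuousOn h, conj_bijOn h, fun ε hε => ?_,
    fun ε hε => ?_, fun n x hx => conj_map h n hx⟩
  · obtain ⟨δ, hδ, hexp⟩ := conj_expands h.symm hG hF hε
    refine ⟨δ, hδ, fun n x hx y hy hxy => ?_⟩
    refine abs_lt_of_expands (hexp n) (conj_mem hx) (conj_mem hy) ?_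
    rwa [conj_conj h n hx, conj_conj h n hy]
  · obtain ⟨δ, hδ, hexp⟩ := conj_expands h hF hG hε
    exact ⟨δ, hδ, fun n x hx y hy hxy =>
      abs_lt_of_expands (hexp n) hx hy hxy⟩

theorem sameItin_of_topConjugate (h : TopConjugate F.a F.b G.a G.b F.f G.f) : SameItin F G := by
  obtain ⟨h, hm, -, hbij, -, -, hconj⟩ := h
  have hturn : ∀ n i, 1 ≤ i → i ≤ l → h n (F.c n i) = G.c n i := by
    intro n i h1 hl
    rw [← IsLModalMap.cextMap_turning (a := F.a) (b := F.b) (cc := F.c n) h1 hl,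
      ← IsLModalMap.cextMap_turning (a := G.a) (b := G.b) (cc := G.c n) h1 hl]
    exact (F.modal n).conj_cextMap (G.modal n) (hm n) (hbij n) (hm (n + 1)) (hconj n) hl
  intro n j h1 hl
  rw [← hturn n j h1 hl]
  exact match_of_conjugacy hm (fun n => (hbij n).mapsTo) hconj hturn n
    ((F.modal n).turning_mem h1 hl)

theorem mem_lapAddr_iff (F : ModalSystem l d) (hl1 : 1 ≤ l) {n i : ℕ} (h1 : 1 ≤ i)
    (hl : i ≤ l + 1) {x : ℝ} (hx : x ∈ F.J) :
    x ∈ lapAddr F.a F.b l F.c n i ↔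
      ∀ k, 1 ≤ k → k ≤ l → (i ≤ k → x < F.c n k) ∧ (k < i → F.c n k < x) := by
  have hM := F.modal n
  have mono : ∀ {s t : ℕ}, 1 ≤ s → s ≤ t → t ≤ l → F.c n s ≤ F.c n t := by
    intro s t hs hst ht
    rcases hst.eq_or_lt with rfl | hlt
    · exact le_rfl
    · exact (hM.turning_lt hs hlt ht).le
  unfold lapAddr
  split_ifs with hi1 hil
  · subst hi1
    refine ⟨fun hmem k hk hkl => ⟨fun _ => hmem.2.trans_le (mono le_rfl hk hkl),
      fun hlt => by omega⟩, fun hall => ⟨hx.1, (hall 1 le_rfl hl1).1 le_rfl⟩⟩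
  · refine ⟨fun hmem k hk hkl => ⟨fun hik => hmem.2.trans_le (mono h1 hik hkl),
      fun hki => (mono hk (by omega) (by omega)).trans_lt hmem.1⟩, fun hall =>
      ⟨(hall (i - 1) (by omega) (by omega)).2 (by omega), (hall i h1 hil).1 le_rfl⟩⟩
  · refine ⟨fun hmem k hk hkl => ⟨fun hik => by omega,
      fun _ => (mono hk hkl le_rfl).trans_lt hmem.1⟩, fun hall =>
      ⟨(hall l hl1 le_rfl).2 (by omega), hx.2⟩⟩

theorem exists_address (F : ModalSystem l d) (hl1 : 1 ≤ l) (n : ℕ) {x : ℝ} (hx : x ∈ F.J) :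
    (∃ i, 1 ≤ i ∧ i ≤ l ∧ x = F.c n i) ∨
      ∃ i, 1 ≤ i ∧ i ≤ l + 1 ∧ x ∈ lapAddr F.a F.b l F.c n i := by
  by_cases hc : ∃ i, 1 ≤ i ∧ i ≤ l ∧ x = F.c n i
  · exact Or.inl hc
  · push Not at hc
    obtain ⟨k, hk, hkx, hkx'⟩ := (F.modal n).exists_lap (x := x) (x' := x) hx.1 hx.2
      fun i _ _ hi => hi.le
    refine Or.inr ⟨k + 1, by omega, by omega, ?_⟩
    rw [F.mem_lapAddr_iff hl1 (by omega) (by omega) hx]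
    intro i h1 hl
    have e := IsLModalMap.cextMap_turning (a := F.a) (b := F.b) (cc := F.c n) h1 hl
    constructor
    · intro hki
      refine lt_of_le_of_ne (hkx'.trans ?_) (hc i h1 hl)
      rw [← e]
      exact (F.modal n).cextMap_le hki (by omega)
    · intro hik
      refine lt_of_le_of_ne (le_trans ?_ hkx) (hc i h1 hl).symm
      rw [← e]
      exact (F.modal n).cextMap_le (by omega) (by omega)

theorem sameItin_iff_sameKneadingM (hl1 : 1 ≤ l) :
    SameItin F G ↔ SameKneadingM F.a F.b G.a G.b l F.f F.c G.f G.c := by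
  constructor
  · intro h j hj hjl n m
    have hM := h n j hj hjl
    have mF := F.iterFrom_mem hM.mem_left n m
    have mG := G.iterFrom_mem hM.mem_right n m
    refine ⟨fun i h1 hl => ?_, fun i h1 hl => ?_⟩
    · have := hM.cmp m i h1 hl
      rw [le_antisymm_iff, le_antisymm_iff, ← not_lt, ← not_lt, ← not_lt, ← not_lt, this.1, this.2]
    · rw [F.mem_lapAddr_iff hl1 h1 hl mF, G.mem_lapAddr_iff hl1 h1 hl mG]
      refine forall_congr' fun k => forall_congr' fun hk => forall_congr' fun hkl => ?_
      rw [(hM.cmp m k hk hkl).1, (hM.cmp m k hk hkl).2]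
  · intro h n j hj hjl
    have mF := (F.modal n).turning_mem hj hjl
    have mG := (G.modal n).turning_mem hj hjl
    refine ⟨mF, mG, fun m k hk hkl => ?_⟩
    have hF := F.iterFrom_mem mF n m
    have hG := G.iterFrom_mem mG n m
    obtain ⟨hT, hL⟩ := h j hj hjl n m
    rcases F.exists_address hl1 (n + m) hF with ⟨i, h1, hl, hi⟩ | ⟨i, h1, hl, hi⟩
    · rw [hi, (hT i h1 hl).mp hi, (F.modal _).turning_lt_iff h1 hl hk hkl,
        (G.modal _).turning_lt_iff h1 hl hk hkl, (F.modal _).turning_lt_iff hk hkl h1 hl,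
        (G.modal _).turning_lt_iff hk hkl h1 hl]
      exact ⟨Iff.rfl, Iff.rfl⟩
    · have c1 := (F.mem_lapAddr_iff hl1 h1 hl hF).mp hi k hk hkl
      have c2 := (G.mem_lapAddr_iff hl1 h1 hl hG).mp ((hL i h1 hl).mp hi) k hk hkl
      rcases le_or_gt i k with hik | hki
      · exact ⟨iff_of_true (c1.1 hik) (c2.1 hik),
          iff_of_false (c1.1 hik).le.not_gt (c2.1 hik).le.not_gt⟩
      · exact ⟨iff_of_false (c1.2 hki).le.not_gt (c2.2 hki).le.not_gt,
          iff_of_true (c1.2 hki) (c2.2 hki)⟩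

/-- The system determined by an `l`-MNDS with dense critical sets. -/
def ofIsMNDS {a b : ℝ} {f : ℕ → ℝ → ℝ} {c : ℕ → ℕ → ℝ} {d' : ℕ → ℕ → Bool}
    (h : IsMNDS a b l f c d') (hd : ∀ n j, 1 ≤ j → j ≤ l + 1 → d' n j = d n j)
    (hdense : ∀ n, Icc a b ⊆ closure (critSetM a b l f c n)) : ModalSystem l d where
  a := a
  b := b
  f := f
  c := c
  modal n := IsLModalMap.congr_types (d := d' n) (h.2.2.2.2 n) (hd n)
  map_left n := by
    refine IsLModalMap.map_left (IsLModalMap.congr_types (d := d' n) (h.2.2.2.2 n) (hd n)) ?_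
    exact h.2.2.1.imp (fun h => h n) (fun h => h n)
  map_right n := by
    refine IsLModalMap.map_right (IsLModalMap.congr_types (d := d' n) (h.2.2.2.2 n) (hd n)) ?_
    exact h.2.2.2.1.imp (fun h => h n) (fun h => h n)
  dense := hdense

end ModalSystem

/-- Two monotonically equivalent `l`-modal nonautonomous discrete dynamical systems,
both satisfying the multimodal limit property, are topologically conjugate if and only
if they have the same kneading sequences. -/
theorem topConjugate_iff_sameKneadingM
    (aF bF aG bG : ℝ) (l : ℕ) (f g : ℕ → ℝ → ℝ)
    (cF cG : ℕ → ℕ → ℝ) (dF dG : ℕ → ℕ → Bool)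
    (hF : IsMNDS aF bF l f cF dF) (hG : IsMNDS aG bG l g cG dG)
    (hmonoEquiv : ∀ n : ℕ, ∀ j : ℕ, 1 ≤ j → j ≤ l + 1 → dF n j = dG n j)
    (hLF : LimitPropertyM aF bF l f cF) (hLG : LimitPropertyM aG bG l g cG) :
    TopConjugate aF bF aG bG f g ↔ SameKneadingM aF bF aG bG l f cF g cG := by
  obtain ⟨φ, p, e, hφ, hp, hφlim, hFdense, hφdense⟩ := hLF
  obtain ⟨γ, q, e', hγ, hq, hγlim, hGdense, hγdense⟩ := hLG
  let F : ModalSystem l dG := ModalSystem.ofIsMNDS hF hmonoEquiv hFdense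
  let G : ModalSystem l dG := ModalSystem.ofIsMNDS hG (fun _ _ _ _ => rfl) hGdense
  have hFL : F.Limit φ p e := ⟨hφ, hp, hφlim, hφdense⟩
  have hGL : G.Limit γ q e' := ⟨hγ, hq, hγlim, hγdense⟩
  have hiff := ModalSystem.sameItin_iff_sameKneadingM (F := F) (G := G) hF.2.1
  exact ⟨fun h => hiff.mp (ModalSystem.sameItin_of_topConjugate (F := F) (G := G) h),
    fun h => ModalSystem.topConjugate_of_sameItin (hiff.mpr h) hFL hGL⟩
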